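/- Let N be an odd prime number and let q be an integer with 1 ≤ q < N. Then the integers 2^q + 1 and 2^(N−q) + 1 are relatively prime. -/

import Mathlib

/-- **Lemma.** If `N` is an odd prime and `1 ≤ q < N`, then `2^q + 1` and `2^(N-q) + 1` are
relatively prime. -/
theorem coprime_two_pow_add_one_of_odd_prime (N q : ℕ) (hN : N.Prime) (hNodd : Odd N)
    (h1 : 1 ≤ q) (h2 : q < N) :
    Nat.Coprime (2 ^ q + 1) (2 ^ (N - q) + 1) := by
  set d := Nat.gcd (2 ^ q + 1) (2 ^ (N - q) + 1)
  have ha : (2 : ZMod d) ^ q = -1 := by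
    have h := (ZMod.natCast_eq_zero_iff _ d).2 (Nat.gcd_dvd_left (2 ^ q + 1) (2 ^ (N - q) + 1))
    push_cast at h
    exact eq_neg_of_add_eq_zero_left h
  have hb : (2 : ZMod d) ^ (N - q) = -1 := by
    have h := (ZMod.natCast_eq_zero_iff _ d).2 (Nat.gcd_dvd_right (2 ^ q + 1) (2 ^ (N - q) + 1))
    push_cast at h
    exact eq_neg_of_add_eq_zero_left h
  have hpowN : (2 : ZMod d) ^ N = 1 := by
    rw [← Nat.add_sub_cancel' h2.le, pow_add, ha, hb]
    ring
  have hpowq : (2 : ZMod d) ^ (2 * q) = 1 := by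
    rw [mul_comm, pow_mul, ha]
    ring
  have hcop : Nat.Coprime N (2 * q) :=
    Nat.Coprime.mul_right (Nat.coprime_two_right.2 hNodd)
      (Nat.coprime_of_lt_prime (by omega) h2 hN)
  have horder : orderOf (2 : ZMod d) = 1 :=
    Nat.eq_one_of_dvd_coprimes hcop (orderOf_dvd_of_pow_eq_one hpowN)
      (orderOf_dvd_of_pow_eq_one hpowq)
  have htwo : (2 : ZMod d) = 1 := orderOf_eq_one_iff.1 horder
  have hone : ((1 : ℕ) : ZMod d) = 0 := by
    push_cast
    linear_combination htwo
  exact Nat.dvd_one.1 ((ZMod.natCast_eq_zero_iff 1 d).1 hone)
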